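/- arXiv:2601.21659 — 7 statements merged into one kernel-verified Lean document; each statement's English description precedes it below -/
import Mathlib

section
/- Let R > 0 and b ≠ 0, c ∈ ℝ be constants, let K : [0,1] × [0,1] → ℝ be integrable, and let p̂ : (0,∞) × ℝ × [0,1] → ℂ be C¹ in (t,μ) and satisfy ∂_t p̂(t,μ,s) = ∫₀¹ K(s,ξ) p̂(t,μ,ξ) dξ − ((1/2)R²μ² + i c μ) p̂(t,μ,s) + b μ ∂_μ p̂(t,μ,s) for all t > 0, μ ∈ ℝ, s ∈ [0,1]. Then the function V(t,μ,s) = p̂(t,μ,s) · exp(−(R²/(4b))(1 − e^{2bt}) μ² − i (c/b)(1 − e^{bt}) μ) satisfies ∂_t V(t,μ,s) = ∫₀¹ K(s,ξ) V(t,μ,ξ) dξ + b μ ∂_μ V(t,μ,s). -/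
open Set MeasureTheory

/-- Time-dependent gauge transformation for the generalized Ornstein–Uhlenbeck
regime-switching model (constant coefficients `b ≠ 0`, `c`, `R > 0`): if
`∂ₜ p̂ = ∫₀¹ K(s,ξ) p̂ dξ − ((1/2)R²μ² + i c μ) p̂ + b μ ∂_μ p̂`, then
`V(t,μ,s) = p̂(t,μ,s) exp(−(R²/(4b))(1 − e^{2bt}) μ² − i (c/b)(1 − e^{bt}) μ)`
satisfies `∂ₜ V = ∫₀¹ K(s,ξ) V dξ + b μ ∂_μ V`. -/
theorem gauge_transform_ou_removes_multiplier
    (R b c : ℝ) (hR : 0 < R) (hb : b ≠ 0)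
    (K : ℝ → ℝ → ℝ)
    (hKint : ∀ s ∈ Icc (0:ℝ) 1, IntervalIntegrable (K s) volume 0 1)
    (phat : ℝ → ℝ → ℝ → ℂ)
    (hC1 : ∀ s ∈ Icc (0:ℝ) 1,
      ContDiffOn ℝ 1 (fun q : ℝ × ℝ => phat q.1 q.2 s) (Ioi (0:ℝ) ×ˢ (univ : Set ℝ)))
    (hpde : ∀ t ∈ Ioi (0:ℝ), ∀ μ : ℝ, ∀ s ∈ Icc (0:ℝ) 1,
      deriv (fun τ => phat τ μ s) t
        = (∫ ξ in (0:ℝ)..1, (K s ξ : ℂ) * phat t μ ξ)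
          - ((1 / 2 : ℂ) * (R : ℂ) ^ 2 * (μ : ℂ) ^ 2 + Complex.I * (c : ℂ) * (μ : ℂ))
            * phat t μ s
          + (b : ℂ) * (μ : ℂ) * deriv (fun ν => phat t ν s) μ)
    (V : ℝ → ℝ → ℝ → ℂ)
    (hV : ∀ t μ s : ℝ, V t μ s
      = phat t μ s
        * Complex.exp (-((R : ℂ) ^ 2 / (4 * (b : ℂ)))
              * (1 - (Real.exp (2 * b * t) : ℂ)) * (μ : ℂ) ^ 2
            - Complex.I * ((c : ℂ) / (b : ℂ)) * (1 - (Real.exp (b * t) : ℂ)) * (μ : ℂ))) :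
    ∀ t ∈ Ioi (0:ℝ), ∀ μ : ℝ, ∀ s ∈ Icc (0:ℝ) 1,
      deriv (fun τ => V τ μ s) t
        = (∫ ξ in (0:ℝ)..1, (K s ξ : ℂ) * V t μ ξ)
          + (b : ℂ) * (μ : ℂ) * deriv (fun ν => V t ν s) μ := by
  intro t ht μ s hs
  have hbC : (b : ℂ) ≠ 0 := by exact_mod_cast hb
  have hopen : IsOpen (Ioi (0:ℝ) ×ˢ (univ : Set ℝ)) := isOpen_Ioi.prod isOpen_univ
  have hd : DifferentiableAt ℝ (fun q : ℝ × ℝ => phat q.1 q.2 s) (t, μ) :=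
    ((hC1 s hs).differentiableOn (by norm_num)).differentiableAt
      (hopen.mem_nhds ⟨ht, mem_univ _⟩)
  have h1 : DifferentiableAt ℝ (fun τ => phat τ μ s) t :=
    DifferentiableAt.comp (f := fun τ : ℝ => (τ, μ)) t hd (by fun_prop)
  have h2 : DifferentiableAt ℝ (fun ν => phat t ν s) μ :=
    DifferentiableAt.comp (f := fun ν : ℝ => (t, ν)) μ hd (by fun_prop)
  have hE : ∀ a : ℝ, HasDerivAt (fun τ : ℝ => (Real.exp (a * τ) : ℂ))
      ((Real.exp (a * t) : ℂ) * a) t := by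
    intro a
    have := (((hasDerivAt_id t).const_mul a).exp).ofReal_comp
    simpa using this
  have hid : HasDerivAt (fun ν : ℝ => (ν : ℂ)) 1 μ := by
    simpa using (hasDerivAt_id μ).ofReal_comp
  have hφt := ((((((hE (2 * b)).const_sub 1).const_mul
      (-((R : ℂ) ^ 2 / (4 * (b : ℂ))))).mul_const ((μ : ℂ) ^ 2)).sub
      ((((hE b).const_sub 1).const_mul
        (Complex.I * ((c : ℂ) / (b : ℂ)))).mul_const (μ : ℂ))).cexp)
  have hφμ := ((((hid.pow 2).const_mul
      (-((R : ℂ) ^ 2 / (4 * (b : ℂ))) * (1 - (Real.exp (2 * b * t) : ℂ)))).sub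
      (hid.const_mul
        (Complex.I * ((c : ℂ) / (b : ℂ)) * (1 - (Real.exp (b * t) : ℂ))))).cexp)
  have e1 := (h1.hasDerivAt.mul hφt).deriv
  have e2 := (h2.hasDerivAt.mul hφμ).deriv
  have hI : (∫ ξ in (0:ℝ)..1, (K s ξ : ℂ) * V t μ ξ)
      = (∫ ξ in (0:ℝ)..1, (K s ξ : ℂ) * phat t μ ξ)
        * Complex.exp (-((R : ℂ) ^ 2 / (4 * (b : ℂ)))
              * (1 - (Real.exp (2 * b * t) : ℂ)) * (μ : ℂ) ^ 2
            - Complex.I * ((c : ℂ) / (b : ℂ)) * (1 - (Real.exp (b * t) : ℂ)) * (μ : ℂ)) := by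
    rw [← intervalIntegral.integral_mul_const]
    congr 1
    funext ξ
    rw [hV]
    ring
  have f1 : (fun τ => V τ μ s) = _ := funext fun τ => hV τ μ s
  have f2 : (fun ν => V t ν s) = _ := funext fun ν => hV t ν s
  rw [hI, f1, f2]
  refine (e1.trans ?_).trans (congrArg _ (congrArg _ e2.symm))
  rw [hpde t ht μ s hs]
  simp only [Pi.sub_apply, Pi.pow_apply, Pi.mul_apply]
  generalize Complex.exp (_ - _) = G
  push_cast
  field_simp
  ring
end

section
/- Let R > 0, c ∈ ℝ, A₁₀ ∈ ℝ, A₁₁ < 0, and let X₁ : [0,1] → ℝ be bounded and integrable with ∫₀¹ X₁(s) ds = 0 and ∫₀¹ X₁(s)² ds = 1. Define K(s,ξ) = A₁₀ X₁(s) + A₁₁ X₁(s) X₁(ξ) and p(t,x,s) = (1 + (A₁₀/A₁₁)(e^{A₁₁ t} − 1) X₁(s)) · (π(1 + 2R²t))^{−1/2} · exp(−(x − ct)² / (1 + 2R²t)). Then p satisfies ∂_t p(t,x,s) = ∫₀¹ K(s,ξ) p(t,x,ξ) dξ − c ∂_x p(t,x,s) + (R²/2) ∂²_x p(t,x,s)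 for all t > 0, x ∈ ℝ, s ∈ [0,1], and p(0,x,s) = π^{−1/2} e^{−x²} for all x, s. -/
open Set MeasureTheory

/-- The explicit function
`p(t,x,s) = (1 + (A₁₀/A₁₁)(e^{A₁₁t} − 1) X₁(s)) (π(1+2R²t))^{-1/2} exp(−(x−ct)²/(1+2R²t))`
solves the integro-differential Kolmogorov forward equation with two-mode kernel
`K(s,ξ) = A₁₀X₁(s) + A₁₁X₁(s)X₁(ξ)`, constant drift `c` and diffusion `R > 0`,
with the Gaussian initial data `π^{-1/2} e^{-x²}` uniform in `s`. -/
theorem explicit_solution_uniform_gaussian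
    (R c A10 A11 : ℝ) (hR : 0 < R) (hA11 : A11 < 0)
    (X1 : ℝ → ℝ)
    (hX1bdd : ∃ M, ∀ s ∈ Icc (0:ℝ) 1, |X1 s| ≤ M)
    (hX1int : IntervalIntegrable X1 volume 0 1)
    (hX1mean : (∫ s in (0:ℝ)..1, X1 s) = 0)
    (hX1norm : (∫ s in (0:ℝ)..1, (X1 s) ^ 2) = 1)
    (K : ℝ → ℝ → ℝ)
    (hK : ∀ s ξ : ℝ, K s ξ = A10 * X1 s + A11 * X1 s * X1 ξ)
    (p : ℝ → ℝ → ℝ → ℝ)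
    (hp : ∀ t x s : ℝ, p t x s
      = (1 + A10 / A11 * (Real.exp (A11 * t) - 1) * X1 s)
        * (1 / Real.sqrt (Real.pi * (1 + 2 * R ^ 2 * t)))
        * Real.exp (-(x - c * t) ^ 2 / (1 + 2 * R ^ 2 * t))) :
    (∀ t ∈ Ioi (0:ℝ), ∀ x : ℝ, ∀ s ∈ Icc (0:ℝ) 1,
      deriv (fun τ => p τ x s) t
        = (∫ ξ in (0:ℝ)..1, K s ξ * p t x ξ)
          - c * deriv (fun y => p t y s) x
          + R ^ 2 / 2 * deriv (deriv (fun y => p t y s)) x)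
    ∧ (∀ x : ℝ, ∀ s ∈ Icc (0:ℝ) 1,
        p 0 x s = (1 / Real.sqrt Real.pi) * Real.exp (-x ^ 2)) := by
  have hA : A11 ≠ 0 := hA11.ne
  constructor
  · intro t ht x s hs
    have ht0 : (0:ℝ) < t := ht
    have hD : 0 < 1 + 2 * R ^ 2 * t := by positivity
    have hDne := hD.ne'
    have hpi := Real.pi_pos
    have hPD : 0 < Real.pi * (1 + 2 * R ^ 2 * t) := by positivity
    have hS : 0 < Real.sqrt (Real.pi * (1 + 2 * R ^ 2 * t)) := Real.sqrt_pos.mpr hPD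
    have hS2 : Real.sqrt (Real.pi * (1 + 2 * R ^ 2 * t)) ^ 2
        = Real.pi * (1 + 2 * R ^ 2 * t) := Real.sq_sqrt hPD.le
    have hX2 : IntervalIntegrable (fun s => X1 s ^ 2) volume 0 1 := by
      apply intervalIntegral.intervalIntegrable_of_integral_ne_zero
      rw [hX1norm]; exact one_ne_zero
    -- the integral term
    have hI : (∫ ξ in (0:ℝ)..1, K s ξ * p t x ξ)
        = A10 * Real.exp (A11 * t) * X1 s
          * (1 / Real.sqrt (Real.pi * (1 + 2 * R ^ 2 * t)))
          * Real.exp (-(x - c * t) ^ 2 / (1 + 2 * R ^ 2 * t)) := by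
      set G := (1 / Real.sqrt (Real.pi * (1 + 2 * R ^ 2 * t)))
          * Real.exp (-(x - c * t) ^ 2 / (1 + 2 * R ^ 2 * t)) with hG
      set a := A10 / A11 * (Real.exp (A11 * t) - 1) with ha
      have h1 : ∀ ξ, K s ξ * p t x ξ = (A10 * X1 s * G
          + (A10 * X1 s * a * G + A11 * X1 s * G) * X1 ξ)
          + (A11 * X1 s * a * G) * X1 ξ ^ 2 := by
        intro ξ
        rw [hK, hp, mul_assoc (1 + _), ← hG]
        ring
      simp_rw [h1]
      rw [intervalIntegral.integral_add
          (intervalIntegrable_const.add (hX1int.const_mul _)) (hX2.const_mul _),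
        intervalIntegral.integral_add intervalIntegrable_const (hX1int.const_mul _),
        intervalIntegral.integral_const_mul _ X1,
        intervalIntegral.integral_const_mul _ (fun ξ => X1 ξ ^ 2),
        hX1mean, hX1norm, intervalIntegral.integral_const, mul_assoc _ (1 / _), ← hG, ha]
      simp only [sub_zero, one_smul]
      field_simp
      ring
    -- space derivatives
    have hE : ∀ y, HasDerivAt
        (fun y => Real.exp (-(y - c * t) ^ 2 / (1 + 2 * R ^ 2 * t)))
        (Real.exp (-(y - c * t) ^ 2 / (1 + 2 * R ^ 2 * t))
          * (-(2 * (y - c * t)) / (1 + 2 * R ^ 2 * t))) y := by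
      intro y
      have := (((((hasDerivAt_id y).sub_const (c * t)).pow 2).neg).div_const
        (1 + 2 * R ^ 2 * t)).exp
      refine this.congr_deriv ?_
      simp
    have hx1 : deriv (fun y => p t y s) = fun y =>
        (1 + A10 / A11 * (Real.exp (A11 * t) - 1) * X1 s)
        * (1 / Real.sqrt (Real.pi * (1 + 2 * R ^ 2 * t)))
        * (Real.exp (-(y - c * t) ^ 2 / (1 + 2 * R ^ 2 * t))
          * (-(2 * (y - c * t)) / (1 + 2 * R ^ 2 * t))) := by
      funext y
      simp_rw [hp]
      exact ((hE y).const_mul _).deriv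
    have hx2 : deriv (deriv (fun y => p t y s)) x =
        (1 + A10 / A11 * (Real.exp (A11 * t) - 1) * X1 s)
        * (1 / Real.sqrt (Real.pi * (1 + 2 * R ^ 2 * t)))
        * (Real.exp (-(x - c * t) ^ 2 / (1 + 2 * R ^ 2 * t))
            * (-(2 * (x - c * t)) / (1 + 2 * R ^ 2 * t))
            * (-(2 * (x - c * t)) / (1 + 2 * R ^ 2 * t))
          + Real.exp (-(x - c * t) ^ 2 / (1 + 2 * R ^ 2 * t))
            * (-(2 * 1) / (1 + 2 * R ^ 2 * t))) := by
      rw [hx1]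
      have hl : HasDerivAt (fun y => -(2 * (y - c * t)) / (1 + 2 * R ^ 2 * t))
          (-(2 * 1) / (1 + 2 * R ^ 2 * t)) x :=
        ((((hasDerivAt_id x).sub_const (c * t)).const_mul 2).neg).div_const _
      exact (((hE x).mul hl).const_mul _).deriv
    -- time derivative
    have hDt : HasDerivAt (fun τ : ℝ => 1 + 2 * R ^ 2 * τ) (2 * R ^ 2) t := by
      simpa using ((hasDerivAt_id t).const_mul (2 * R ^ 2)).const_add 1
    have hSt : HasDerivAt (fun τ : ℝ => 1 / Real.sqrt (Real.pi * (1 + 2 * R ^ 2 * τ)))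
        (-(R ^ 2 / (1 + 2 * R ^ 2 * t))
          * (1 / Real.sqrt (Real.pi * (1 + 2 * R ^ 2 * t)))) t := by
      have := ((hDt.const_mul Real.pi).sqrt hPD.ne').inv hS.ne'
      simp_rw [one_div]
      refine this.congr_deriv ?_
      rw [hS2]
      field_simp
    have hAt : HasDerivAt (fun τ : ℝ => 1 + A10 / A11 * (Real.exp (A11 * τ) - 1) * X1 s)
        (A10 * Real.exp (A11 * t) * X1 s) t := by
      have := ((((((hasDerivAt_id t).const_mul A11).exp).sub_const 1).const_mul
        (A10 / A11)).mul_const (X1 s)).const_add 1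
      refine this.congr_deriv ?_
      simp only [id]
      field_simp
    have hEt : HasDerivAt (fun τ : ℝ => Real.exp (-(x - c * τ) ^ 2 / (1 + 2 * R ^ 2 * τ)))
        (Real.exp (-(x - c * t) ^ 2 / (1 + 2 * R ^ 2 * t))
          * ((2 * c * (x - c * t) * (1 + 2 * R ^ 2 * t) + (x - c * t) ^ 2 * (2 * R ^ 2))
            / (1 + 2 * R ^ 2 * t) ^ 2)) t := by
      have := (((((((hasDerivAt_id t).const_mul c).const_sub x).pow 2).neg).div hDt hDne)).exp
      refine this.congr_deriv ?_
      simp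
      ring
    have hT0 : (fun τ => p τ x s) = fun τ => _ := funext fun τ => hp τ x s
    have hT := ((hAt.mul hSt).mul hEt).deriv
    replace hT := (congrArg (fun f => deriv f t) hT0).trans hT
    simp only [Pi.mul_apply] at hT
    rw [hT, hI, hx2, hx1]
    beta_reduce
    generalize Real.exp (-(x - c * t) ^ 2 / (1 + 2 * R ^ 2 * t)) = E
    generalize 1 / Real.sqrt (Real.pi * (1 + 2 * R ^ 2 * t)) = S
    generalize 1 + A10 / A11 * (Real.exp (A11 * t) - 1) * X1 s = B
    generalize 1 + 2 * R ^ 2 * t = D at *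
    field_simp
    ring
  · intro x s hs
    rw [hp]
    simp
end

section
/- Let R > 0, b < 0, c ∈ ℝ, A₁₀ ∈ ℝ, A₁₁ < 0, and let X₁ : [0,1] → ℝ be bounded and integrable with ∫₀¹ X₁(s) ds = 0 and ∫₀¹ X₁(s)² ds = 1. Define K(s,ξ) = A₁₀ X₁(s) + A₁₁ X₁(s) X₁(ξ) and, for t > 0, p(t,x,s) = (1 + (A₁₀/A₁₁)(e^{A₁₁ t} − 1) X₁(s)) · (−π (R²/b)(1 − e^{2bt}))^{−1/2} · exp(−(x + (c/b)(1 − e^{bt}))² / (−(R²/b)(1 − e^{2bt}))). Then (i) p satisfies ∂_t p(t,x,s) = ∫₀¹ K(s,ξ) p(t,x,ξ) dξ − ∂_x((bx + c) p(t,x,s)) + (R²/2) ∂²_x p(t,x,s) for all t > 0, x ∈ ℝ, s ∈ [0,1]; and (ii) for every bounded continuous f : ℝ → ℝ and every s ∈ [0,1], ∫_ℝ p(t,x,s) f(x) dx → f(0) as t → 0⁺. -/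
open Set MeasureTheory Filter

lemma ou_G_x (V m x : ℝ) (hV : 0 < V) :
    HasDerivAt (fun y : ℝ => Real.exp (-(y + m) ^ 2 / V))
      (-2 * (x + m) / V * Real.exp (-(x + m) ^ 2 / V)) x := by
  have h1 : HasDerivAt (fun y : ℝ => -(y + m) ^ 2 / V) (-2 * (x + m) / V) x := by
    have := (((hasDerivAt_id x).add_const m).pow 2).neg.div_const V
    refine this.congr_deriv ?_
    simp
  exact h1.exp.congr_deriv (by ring)

lemma ou_G_xx (V m x : ℝ) (hV : 0 < V) :
    HasDerivAt (fun y : ℝ => -2 * (y + m) / V * Real.exp (-(y + m) ^ 2 / V))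
      ((4 * (x + m) ^ 2 / V ^ 2 - 2 / V) * Real.exp (-(x + m) ^ 2 / V)) x := by
  have h1 : HasDerivAt (fun y : ℝ => -2 * (y + m) / V) (-2 / V) x := by
    have := (((hasDerivAt_id x).add_const m).const_mul (-2)).div_const V
    refine this.congr_deriv ?_
    simp
  refine (h1.mul (ou_G_x V m x hV)).congr_deriv ?_
  field_simp
  ring

lemma ou_G_t (V m : ℝ → ℝ) (V' m' x t : ℝ) (hV : 0 < V t)
    (hV' : HasDerivAt V V' t) (hm' : HasDerivAt m m' t) :
    HasDerivAt (fun τ : ℝ => 1 / Real.sqrt (Real.pi * V τ) * Real.exp (-(x + m τ) ^ 2 / V τ))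
      ((-V' / (2 * V t) + (x + m t) ^ 2 * V' / V t ^ 2 - 2 * (x + m t) * m' / V t)
        * (1 / Real.sqrt (Real.pi * V t) * Real.exp (-(x + m t) ^ 2 / V t))) t := by
  have hpos : 0 < Real.pi * V t := by positivity
  have hs : 0 < Real.sqrt (Real.pi * V t) := Real.sqrt_pos.2 hpos
  have h0 := ((hV'.const_mul Real.pi).sqrt hpos.ne').inv hs.ne'
  have h1 : HasDerivAt (fun τ : ℝ => 1 / Real.sqrt (Real.pi * V τ))
      (-V' / (2 * V t) * (1 / Real.sqrt (Real.pi * V t))) t := by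
    simp only [one_div]
    refine h0.congr_deriv ?_
    rw [Real.sq_sqrt hpos.le]
    field_simp
  have h2 : HasDerivAt (fun τ : ℝ => -(x + m τ) ^ 2 / V τ)
      ((x + m t) ^ 2 * V' / V t ^ 2 - 2 * (x + m t) * m' / V t) t := by
    refine ((((hm'.const_add x).pow 2).neg).div hV' hV.ne').congr_deriv ?_
    simp
    field_simp
    ring
  refine (h1.mul h2.exp).congr_deriv ?_
  ring

lemma ou_weak (V m : ℝ → ℝ) (hV : ∀ t ∈ Ioi (0:ℝ), 0 < V t)
    (hV0 : Tendsto V (nhdsWithin 0 (Ioi 0)) (nhds 0))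
    (hm0 : Tendsto m (nhdsWithin 0 (Ioi 0)) (nhds 0))
    (f : ℝ → ℝ) (hf : Continuous f) (M : ℝ) (hM : ∀ x, |f x| ≤ M) :
    Tendsto (fun t => ∫ x : ℝ, 1 / Real.sqrt (Real.pi * V t) * Real.exp (-(x + m t) ^ 2 / V t) * f x)
      (nhdsWithin 0 (Ioi 0)) (nhds (f 0)) := by
  have key : ∀ t ∈ Ioi (0:ℝ),
      (∫ x : ℝ, 1 / Real.sqrt (Real.pi * V t) * Real.exp (-(x + m t) ^ 2 / V t) * f x)
      = ∫ y : ℝ, 1 / Real.sqrt Real.pi * Real.exp (-1 * y ^ 2) * f (Real.sqrt (V t) * y - m t) := by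
    intro t ht
    have hv := hV t ht
    have hs : 0 < Real.sqrt (V t) := Real.sqrt_pos.2 hv
    rw [← integral_sub_right_eq_self _ (m t)]
    have := Measure.integral_comp_mul_left (fun x : ℝ => 1 / Real.sqrt (Real.pi * V t) *
      Real.exp (-(x - m t + m t) ^ 2 / V t) * f (x - m t)) (Real.sqrt (V t))
    rw [abs_of_pos (inv_pos.2 hs), smul_eq_mul, eq_comm, inv_mul_eq_iff_eq_mul₀ hs.ne'] at this
    rw [this, ← integral_const_mul]
    congr 1
    ext y
    have e : -(Real.sqrt (V t) * y - m t + m t) ^ 2 / V t = -1 * y ^ 2 := by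
      rw [sub_add_cancel, mul_pow, Real.sq_sqrt hv.le]
      field_simp
    rw [e, Real.sqrt_mul Real.pi_pos.le]
    have := Real.sqrt_pos.2 Real.pi_pos
    field_simp
  have hlim : f 0 = ∫ y : ℝ, 1 / Real.sqrt Real.pi * Real.exp (-1 * y ^ 2) * f 0 := by
    rw [integral_mul_const, integral_const_mul, integral_gaussian]
    have := Real.sqrt_pos.2 Real.pi_pos
    simp only [div_one]
    field_simp
  rw [hlim]
  have hcongr := eventually_nhdsWithin_of_forall (s := Ioi (0:ℝ)) (a := 0) key
  refine Tendsto.congr' (EventuallyEq.symm hcongr) ?_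
  refine tendsto_integral_filter_of_dominated_convergence
    (fun y => 1 / Real.sqrt Real.pi * Real.exp (-1 * y ^ 2) * M) ?_ ?_ ?_ ?_
  · refine Eventually.of_forall fun t => Continuous.aestronglyMeasurable ?_
    fun_prop
  · refine Eventually.of_forall fun t => Eventually.of_forall fun y => ?_
    rw [norm_mul, Real.norm_of_nonneg (by positivity)]
    exact mul_le_mul_of_nonneg_left (hM _) (by positivity)
  · exact ((integrable_exp_neg_mul_sq one_pos).const_mul _).mul_const _
  · refine Eventually.of_forall fun y => Tendsto.const_mul _ ?_
    refine (hf.tendsto 0).comp ?_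
    have := (((Real.continuous_sqrt.tendsto 0).comp hV0).mul_const y).sub hm0
    simpa using this

/-- The explicit function
`p(t,x,s) = (1 + (A₁₀/A₁₁)(e^{A₁₁t} − 1) X₁(s)) (−π(R²/b)(1−e^{2bt}))^{-1/2}
  exp(−(x + (c/b)(1−e^{bt}))² / (−(R²/b)(1−e^{2bt})))`
solves the generalized Ornstein–Uhlenbeck regime-switching Kolmogorov forward
equation with two-mode kernel `K(s,ξ) = A₁₀X₁(s) + A₁₁X₁(s)X₁(ξ)`,
and attains the Dirac initial data `δ(x)` (uniform in `s`) in the weak sense. -/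
theorem explicit_ou_solution_dirac_data
    (R b c A10 A11 : ℝ) (hR : 0 < R) (hb : b < 0) (hA11 : A11 < 0)
    (X1 : ℝ → ℝ)
    (hX1bdd : ∃ M, ∀ s ∈ Icc (0:ℝ) 1, |X1 s| ≤ M)
    (hX1int : IntervalIntegrable X1 volume 0 1)
    (hX1mean : (∫ s in (0:ℝ)..1, X1 s) = 0)
    (hX1norm : (∫ s in (0:ℝ)..1, (X1 s) ^ 2) = 1)
    (K : ℝ → ℝ → ℝ)
    (hK : ∀ s ξ : ℝ, K s ξ = A10 * X1 s + A11 * X1 s * X1 ξ)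
    (p : ℝ → ℝ → ℝ → ℝ)
    (hp : ∀ t ∈ Ioi (0:ℝ), ∀ x s : ℝ, p t x s
      = (1 + A10 / A11 * (Real.exp (A11 * t) - 1) * X1 s)
        * (1 / Real.sqrt (-(Real.pi * (R ^ 2 / b) * (1 - Real.exp (2 * b * t)))))
        * Real.exp (-(x + c / b * (1 - Real.exp (b * t))) ^ 2
            / (-(R ^ 2 / b) * (1 - Real.exp (2 * b * t))))) :
    -- (i) the equation holds for t > 0
    (∀ t ∈ Ioi (0:ℝ), ∀ x : ℝ, ∀ s ∈ Icc (0:ℝ) 1,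
      deriv (fun τ => p τ x s) t
        = (∫ ξ in (0:ℝ)..1, K s ξ * p t x ξ)
          - deriv (fun y => (b * y + c) * p t y s) x
          + R ^ 2 / 2 * deriv (deriv (fun y => p t y s)) x)
    -- (ii) the Dirac initial condition in the weak sense
    ∧ (∀ f : ℝ → ℝ, Continuous f → (∃ M, ∀ x : ℝ, |f x| ≤ M) →
        ∀ s ∈ Icc (0:ℝ) 1,
          Tendsto (fun t => ∫ x : ℝ, p t x s * f x) (nhdsWithin 0 (Ioi 0))
            (nhds (f 0))) := by
  have hb0 : b ≠ 0 := hb.ne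
  have hA0 : A11 ≠ 0 := hA11.ne
  set V : ℝ → ℝ := fun t => -(R ^ 2 / b) * (1 - Real.exp (2 * b * t)) with hVdef
  set m : ℝ → ℝ := fun t => c / b * (1 - Real.exp (b * t)) with hmdef
  set a : ℝ → ℝ → ℝ := fun t s => 1 + A10 / A11 * (Real.exp (A11 * t) - 1) * X1 s with hadef
  have hVpos : ∀ t ∈ Ioi (0:ℝ), 0 < V t := by
    intro t ht
    have ht' : 0 < t := ht
    have h1 : Real.exp (2 * b * t) < 1 := by
      rw [Real.exp_lt_one_iff]
      nlinarith
    have h2 : 0 < -(R ^ 2 / b) := by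
      rw [← div_neg]
      exact div_pos (by positivity) (by linarith)
    exact mul_pos h2 (by linarith)
  have hp' : ∀ t ∈ Ioi (0:ℝ), ∀ x s : ℝ, p t x s = a t s *
      (1 / Real.sqrt (Real.pi * V t) * Real.exp (-(x + m t) ^ 2 / V t)) := by
    intro t ht x s
    rw [hp t ht x s, mul_assoc]
    have : -(Real.pi * (R ^ 2 / b) * (1 - Real.exp (2 * b * t))) = Real.pi * V t := by
      simp only [hVdef]; ring
    rw [this]
  have hexp : ∀ k t : ℝ, HasDerivAt (fun τ : ℝ => Real.exp (k * τ)) (k * Real.exp (k * t)) t := by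
    intro k t
    exact (((hasDerivAt_id t).const_mul k).exp).congr_deriv (by simp; ring)
  have hVd : ∀ t, HasDerivAt V (2 * b * V t + 2 * R ^ 2) t := by
    intro t
    refine (((hexp (2 * b) t).const_sub 1).const_mul (-(R ^ 2 / b))).congr_deriv ?_
    simp only [hVdef]
    field_simp
    ring
  have hmd : ∀ t, HasDerivAt m (b * m t - c) t := by
    intro t
    refine (((hexp b t).const_sub 1).const_mul (c / b)).congr_deriv ?_
    simp only [hmdef]
    field_simp
    ring
  have had : ∀ t s, HasDerivAt (fun τ => a τ s) (A10 * Real.exp (A11 * t) * X1 s) t := by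
    intro t s
    refine (((((hexp A11 t).sub_const 1).const_mul (A10 / A11)).mul_const (X1 s)).const_add 1).congr_deriv ?_
    field_simp
  refine ⟨?_, ?_⟩
  · intro t ht x s hs
    have hv := hVpos t ht
    set g : ℝ := 1 / Real.sqrt (Real.pi * V t) with hg
    have hX2 : IntervalIntegrable (fun s => X1 s ^ 2) volume 0 1 := by
      by_contra h
      rw [intervalIntegral.integral_undef h] at hX1norm
      exact zero_ne_one hX1norm
    have e1 : deriv (fun τ => p τ x s) t = A10 * Real.exp (A11 * t) * X1 s *
        (g * Real.exp (-(x + m t) ^ 2 / V t)) + a t s *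
        ((-(2 * b * V t + 2 * R ^ 2) / (2 * V t) + (x + m t) ^ 2 * (2 * b * V t + 2 * R ^ 2) / V t ^ 2
          - 2 * (x + m t) * (b * m t - c) / V t) * (g * Real.exp (-(x + m t) ^ 2 / V t))) := by
      have h := (had t s).mul (ou_G_t V m _ _ x t hv (hVd t) (hmd t))
      refine (h.congr_of_eventuallyEq ?_).deriv
      filter_upwards [Ioi_mem_nhds ht] with τ hτ
      exact hp' τ hτ x s
    have hfun : (fun y => p t y s) = fun y => a t s * (g * Real.exp (-(y + m t) ^ 2 / V t)) :=
      funext fun y => hp' t ht y s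
    have d1 : ∀ y, HasDerivAt (fun y => p t y s)
        (a t s * (g * (-2 * (y + m t) / V t * Real.exp (-(y + m t) ^ 2 / V t)))) y := by
      intro y
      rw [hfun]
      exact ((ou_G_x (V t) (m t) y hv).const_mul g).const_mul _
    have e2 : deriv (fun y => (b * y + c) * p t y s) x = b * p t x s + (b * x + c) *
        (a t s * (g * (-2 * (x + m t) / V t * Real.exp (-(x + m t) ^ 2 / V t)))) := by
      have hl : HasDerivAt (fun y : ℝ => b * y + c) b x :=
        (((hasDerivAt_id x).const_mul b).add_const c).congr_deriv (by simp)
      exact (hl.mul (d1 x)).deriv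
    have e3 : deriv (deriv (fun y => p t y s)) x = a t s * (g *
        ((4 * (x + m t) ^ 2 / V t ^ 2 - 2 / V t) * Real.exp (-(x + m t) ^ 2 / V t))) := by
      rw [show deriv (fun y => p t y s) = _ from funext fun y => (d1 y).deriv]
      exact (((ou_G_xx (V t) (m t) x hv).const_mul g).const_mul _).deriv
    have e4 : (∫ ξ in (0:ℝ)..1, K s ξ * p t x ξ) = A10 * Real.exp (A11 * t) * X1 s *
        (g * Real.exp (-(x + m t) ^ 2 / V t)) := by
      set G : ℝ := g * Real.exp (-(x + m t) ^ 2 / V t) with hG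
      set k : ℝ := A10 / A11 * (Real.exp (A11 * t) - 1) with hk
      have : (fun ξ => K s ξ * p t x ξ) = fun ξ => (A10 * X1 s * G +
          (A11 * X1 s * G + A10 * X1 s * k * G) * X1 ξ) + A11 * X1 s * k * G * X1 ξ ^ 2 := by
        ext ξ
        rw [hK, hp' t ht x ξ]
        simp only [hadef, ← hg, ← hG, ← hk]
        ring
      rw [this, intervalIntegral.integral_add, intervalIntegral.integral_add,
        intervalIntegral.integral_const, intervalIntegral.integral_const_mul, intervalIntegral.integral_const_mul, hX1mean, hX1norm]
      · simp [hk]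
        field_simp
        ring
      · simp
      · exact hX1int.const_mul _
      · exact (by simp : IntervalIntegrable (fun _ => A10 * X1 s * G) volume 0 1).add
          (hX1int.const_mul _)
      · exact hX2.const_mul _
    rw [e1, e2, e3, e4, hp' t ht x s, ← hg]
    generalize Real.exp (-(x + m t) ^ 2 / V t) = E
    generalize V t = v at *
    generalize m t = μ at *
    field_simp
    ring
  · intro f hf ⟨M, hM⟩ s hs
    have hV0 : Tendsto V (nhdsWithin 0 (Ioi 0)) (nhds 0) := by
      have := (hVd 0).continuousAt.tendsto
      simp only [hVdef, mul_zero, Real.exp_zero, sub_self] at this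
      exact this.mono_left nhdsWithin_le_nhds
    have hm0 : Tendsto m (nhdsWithin 0 (Ioi 0)) (nhds 0) := by
      have := (hmd 0).continuousAt.tendsto
      simp only [hmdef, mul_zero, Real.exp_zero, sub_self] at this
      exact this.mono_left nhdsWithin_le_nhds
    have ha0 : Tendsto (fun t => a t s) (nhdsWithin 0 (Ioi 0)) (nhds 1) := by
      have := (had 0 s).continuousAt.tendsto
      simp only [hadef, mul_zero, Real.exp_zero, sub_self, zero_mul, add_zero] at this
      exact this.mono_left nhdsWithin_le_nhds
    have h := ha0.mul (ou_weak V m hVpos hV0 hm0 f hf M hM)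
    rw [one_mul] at h
    refine h.congr' ?_
    filter_upwards [self_mem_nhdsWithin] with t ht
    rw [← integral_const_mul]
    congr 1
    ext x
    rw [hp' t ht x s]
    ring
end

section
/- Let R > 0, b < 0, c ∈ ℝ, A₁₀ ≥ 0, A₁₁ < 0, t > 0 and y ∈ ℝ. With D(η) = −(R²/b)(1 − e^{2bt}) + e^{2(η−t)}, J(η) = D(η)^{−1/2} exp(−y²/D(η)), J₁ = (−(R²/b)(1 − e^{2bt}) + 1)^{−1/2} exp(−y²/(−(R²/b)(1 − e^{2bt}) + e^{−2t})) and J₂ = (−(R²/b)(1 − e^{2bt}) + e^{−2t})^{−1/2} exp(−y²/(−(R²/b)(1 − e^{2bt}) + 1)), define B₁ = (A₁₀/√π) ∫₀^t e^{A₁₁(t − η)} J(η) dη. Then (A₁₀ (e^{A₁₁ t} − 1) / (A₁₁ √π)) · J₁ ≤ B₁ ≤ (A₁₀ (e^{A₁₁ t} − 1) / (A₁₁ √π)) · J₂. -/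
open Set

/-- Two-sided bound for the first-mode coefficient
`B₁ = (A₁₀/√π) ∫₀ᵗ e^{A₁₁(t−η)} J(η) dη` in the mean-reverting case `b < 0`:
`(A₁₀(e^{A₁₁t} − 1)/(A₁₁√π)) J₁ ≤ B₁ ≤ (A₁₀(e^{A₁₁t} − 1)/(A₁₁√π)) J₂`. -/
theorem sandwich_bound_for_B1
    (R b c A10 A11 t y : ℝ)
    (hR : 0 < R) (hb : b < 0) (hA10 : 0 ≤ A10) (hA11 : A11 < 0) (ht : 0 < t)
    (D J : ℝ → ℝ) (J1 J2 B1 : ℝ)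
    (hD : ∀ η : ℝ, D η = -(R ^ 2 / b) * (1 - Real.exp (2 * b * t)) + Real.exp (2 * (η - t)))
    (hJ : ∀ η : ℝ, J η = (1 / Real.sqrt (D η)) * Real.exp (-y ^ 2 / D η))
    (hJ1 : J1 = (1 / Real.sqrt (-(R ^ 2 / b) * (1 - Real.exp (2 * b * t)) + 1))
        * Real.exp (-y ^ 2
            / (-(R ^ 2 / b) * (1 - Real.exp (2 * b * t)) + Real.exp (-2 * t))))
    (hJ2 : J2 = (1 / Real.sqrt (-(R ^ 2 / b) * (1 - Real.exp (2 * b * t)) + Real.exp (-2 * t)))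
        * Real.exp (-y ^ 2 / (-(R ^ 2 / b) * (1 - Real.exp (2 * b * t)) + 1)))
    (hB1 : B1 = (A10 / Real.sqrt Real.pi)
        * ∫ η in (0:ℝ)..t, Real.exp (A11 * (t - η)) * J η) :
    A10 * (Real.exp (A11 * t) - 1) / (A11 * Real.sqrt Real.pi) * J1 ≤ B1
    ∧ B1 ≤ A10 * (Real.exp (A11 * t) - 1) / (A11 * Real.sqrt Real.pi) * J2 := by
  have hK : 0 ≤ -(R ^ 2 / b) * (1 - Real.exp (2 * b * t)) := by
    apply mul_nonneg
    · have := div_nonpos_of_nonneg_of_nonpos (sq_nonneg R) hb.le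
      linarith
    · have : Real.exp (2 * b * t) ≤ 1 := Real.exp_le_one_iff.mpr (by nlinarith)
      linarith
  generalize -(R ^ 2 / b) * (1 - Real.exp (2 * b * t)) = K at *
  have hDpos : ∀ η, 0 < D η := fun η => by
    rw [hD]; have := Real.exp_pos (2 * (η - t)); linarith
  have hDc : Continuous D := by
    rw [show D = _ from funext hD]; fun_prop
  have hJc : Continuous J := by
    rw [show J = _ from funext hJ]
    refine Continuous.mul (Continuous.div continuous_const (by fun_prop) fun η => ?_) ?_
    · exact (Real.sqrt_pos.mpr (hDpos η)).ne'
    · exact Real.continuous_exp.comp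
        (Continuous.div continuous_const hDc fun η => (hDpos η).ne')
  have key : ∀ p q r : ℝ, 0 < p → p ≤ q → q ≤ r →
      1 / Real.sqrt r * Real.exp (-y ^ 2 / p) ≤ 1 / Real.sqrt q * Real.exp (-y ^ 2 / q) ∧
      1 / Real.sqrt q * Real.exp (-y ^ 2 / q) ≤ 1 / Real.sqrt p * Real.exp (-y ^ 2 / r) := by
    intro p q r hp hpq hqr
    have hq : 0 < q := by linarith
    have e : ∀ u v : ℝ, 0 < u → u ≤ v → Real.exp (-y ^ 2 / u) ≤ Real.exp (-y ^ 2 / v) := by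
      intro u v hu huv
      apply Real.exp_le_exp.mpr
      rw [neg_div, neg_div]
      exact neg_le_neg (div_le_div_of_nonneg_left (sq_nonneg y) hu huv)
    have g : ∀ u v : ℝ, 0 < u → u ≤ v → 1 / Real.sqrt v ≤ 1 / Real.sqrt u := by
      intro u v hu huv
      exact one_div_le_one_div_of_le (Real.sqrt_pos.mpr hu) (Real.sqrt_le_sqrt huv)
    exact ⟨mul_le_mul (g _ _ hq hqr) (e _ _ hp hpq) (Real.exp_pos _).le (by positivity),
      mul_le_mul (g _ _ hp hpq) (e _ _ hq hqr) (Real.exp_pos _).le (by positivity)⟩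
  have hJb : ∀ η ∈ Set.Icc 0 t, J1 ≤ J η ∧ J η ≤ J2 := by
    intro η hη
    rw [hJ1, hJ2, hJ]
    apply key
    · have := Real.exp_pos (-2 * t); linarith
    · rw [hD]
      have : Real.exp (-2 * t) ≤ Real.exp (2 * (η - t)) :=
        Real.exp_le_exp.mpr (by linarith [hη.1])
      linarith
    · rw [hD]
      have : Real.exp (2 * (η - t)) ≤ 1 := Real.exp_le_one_iff.mpr (by linarith [hη.2])
      linarith
  have hI : ∫ η in (0:ℝ)..t, Real.exp (A11 * (t - η)) = (Real.exp (A11 * t) - 1) / A11 := by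
    have hd : ∀ x ∈ Set.uIcc 0 t, HasDerivAt (fun η => -(Real.exp (A11 * (t - η)) / A11))
        (Real.exp (A11 * (t - x))) x := by
      intro x _
      have h := ((((hasDerivAt_id x).const_sub t).const_mul A11).exp.div_const A11).neg
      have hne := hA11.ne
      have e : -(Real.exp (A11 * (t - x)) * (A11 * -1) / A11) = Real.exp (A11 * (t - x)) := by
        field_simp
      rw [← e]
      exact h
    rw [intervalIntegral.integral_eq_sub_of_hasDerivAt hd
      (Continuous.intervalIntegrable (by fun_prop) _ _)]
    simp
    ring
  have hc : ∀ M : ℝ, A10 * (Real.exp (A11 * t) - 1) / (A11 * Real.sqrt Real.pi) * M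
      = A10 / Real.sqrt Real.pi * ∫ η in (0:ℝ)..t, Real.exp (A11 * (t - η)) * M := by
    intro M
    rw [intervalIntegral.integral_mul_const, hI]
    have := hA11.ne
    have := (Real.sqrt_pos.mpr Real.pi_pos).ne'
    field_simp
  rw [hc, hc, hB1]
  have h0 : 0 ≤ A10 / Real.sqrt Real.pi := by positivity
  constructor
  · refine mul_le_mul_of_nonneg_left (intervalIntegral.integral_mono_on ht.le
      (Continuous.intervalIntegrable (by fun_prop) _ _)
      (Continuous.intervalIntegrable (by fun_prop) _ _) fun η hη => ?_) h0
    exact mul_le_mul_of_nonneg_left (hJb η hη).1 (Real.exp_pos _).le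
  · refine mul_le_mul_of_nonneg_left (intervalIntegral.integral_mono_on ht.le
      (Continuous.intervalIntegrable (by fun_prop) _ _)
      (Continuous.intervalIntegrable (by fun_prop) _ _) fun η hη => ?_) h0
    exact mul_le_mul_of_nonneg_left (hJb η hη).2 (Real.exp_pos _).le
end

section
/- Let R > 0, c ∈ ℝ, m₁, m₂ ∈ ℝ, A₁₀ ∈ ℝ, A₁₁ < 0, and let X₁ : [0,1] → ℝ be bounded and integrable with ∫₀¹ X₁(s) ds = 0 and ∫₀¹ X₁(s)² ds = 1. Define K(s,ξ) = A₁₀ X₁(s) + A₁₁ X₁(s) X₁(ξ), B₀(t,x) = (2√(π(1+2R²t)))^{−1}(e^{−(x−m₁−ct)²/(1+2R²t)} + e^{−(x−m₂−ct)²/(1+2R²t)}), B₁(t,x) = (2√(π(1+2R²t)))^{−1}(e^{−(x−m₁−ct)²/(1+2R²t)} − e^{−(x−m₂−ct)²/(1+2R²t)}), and p(t,x,s) = B₀(t,x) + (e^{A₁₁ t} B₁(t,x) + (A₁₀/A₁₁)(e^{A₁₁ t} − 1) B₀(t,x)) X₁(s). Then p satisfies ∂_t p(t,x,s) = ∫₀¹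 K(s,ξ) p(t,x,ξ) dξ − c ∂_x p(t,x,s) + (R²/2) ∂²_x p(t,x,s) for all t > 0, x ∈ ℝ, s ∈ [0,1], with p(0,x,s) = g₀(x) + g₁(x) X₁(s), where g₀(x) = (2√π)^{−1}(e^{−(x−m₁)²} + e^{−(x−m₂)²}) and g₁(x) = (2√π)^{−1}(e^{−(x−m₁)²} − e^{−(x−m₂)²}). -/
open Set MeasureTheory

noncomputable def uK (R c m t x : ℝ) : ℝ :=
  (1 / (2 * Real.sqrt (Real.pi * (1 + 2 * R ^ 2 * t)))) *
    Real.exp (-(x - m - c * t) ^ 2 / (1 + 2 * R ^ 2 * t))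

lemma uK_x (R c m t x : ℝ) : HasDerivAt (fun y => uK R c m t y)
    (uK R c m t x * (-2 * (x - m - c * t) / (1 + 2 * R ^ 2 * t))) x := by
  unfold uK
  have h1 : HasDerivAt (fun y : ℝ => y - m - c * t) 1 x :=
    ((hasDerivAt_id x).sub_const m).sub_const (c * t)
  have h2 := ((((h1.pow 2).neg).div_const (1 + 2 * R ^ 2 * t)).exp).const_mul
    (1 / (2 * Real.sqrt (Real.pi * (1 + 2 * R ^ 2 * t))))
  refine h2.congr_deriv ?_
  simp
  ring

lemma uK_xx (R c m t x : ℝ) :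
    HasDerivAt (fun y => uK R c m t y * (-2 * (y - m - c * t) / (1 + 2 * R ^ 2 * t)))
    (uK R c m t x * ((-2 * (x - m - c * t) / (1 + 2 * R ^ 2 * t)) ^ 2
      - 2 / (1 + 2 * R ^ 2 * t))) x := by
  have h1 : HasDerivAt (fun y : ℝ => y - m - c * t) 1 x :=
    ((hasDerivAt_id x).sub_const m).sub_const (c * t)
  have h2 := (uK_x R c m t x).mul ((h1.const_mul (-2)).div_const (1 + 2 * R ^ 2 * t))
  refine h2.congr_deriv ?_
  ring

lemma uK_t (R c m t x : ℝ) (ht : 0 < t) : HasDerivAt (fun τ => uK R c m τ x)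
    (- c * (uK R c m t x * (-2 * (x - m - c * t) / (1 + 2 * R ^ 2 * t)))
      + R ^ 2 / 2 * (uK R c m t x * ((-2 * (x - m - c * t) / (1 + 2 * R ^ 2 * t)) ^ 2
      - 2 / (1 + 2 * R ^ 2 * t)))) t := by
  unfold uK
  have hT : 0 < 1 + 2 * R ^ 2 * t := by positivity
  have hPT : 0 < Real.pi * (1 + 2 * R ^ 2 * t) := by positivity
  have hS : 0 < Real.sqrt (Real.pi * (1 + 2 * R ^ 2 * t)) := Real.sqrt_pos.mpr hPT
  have h0 : HasDerivAt (fun τ : ℝ => 1 + 2 * R ^ 2 * τ) (2 * R ^ 2) t := by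
    simpa using ((hasDerivAt_id t).const_mul (2 * R ^ 2)).const_add 1
  have h1 : HasDerivAt (fun τ : ℝ => x - m - c * τ) (-c) t := by
    simpa using ((hasDerivAt_id t).const_mul c).const_sub (x - m)
  have h3 := (((h1.pow 2).neg).div h0 hT.ne').exp
  have h4 := (((h0.const_mul Real.pi).sqrt hPT.ne').const_mul 2)
  have h5 := ((hasDerivAt_const t (1:ℝ)).div h4 (by positivity)).mul h3
  refine h5.congr_deriv ?_
  have hsq := Real.sq_sqrt hPT.le
  simp only [Pi.neg_apply, Pi.pow_apply, Pi.div_apply]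
  generalize Real.exp (-(x - m - c * t) ^ 2 / (1 + 2 * R ^ 2 * t)) = E
  generalize Real.sqrt (Real.pi * (1 + 2 * R ^ 2 * t)) = S at *
  generalize hTT : 1 + 2 * R ^ 2 * t = T at *
  generalize x - m - c * t = z
  have hk : Real.pi / S ^ 2 = 1 / T := by
    rw [hsq]; field_simp
  have e1 : (0 * (2 * S) - 1 * (2 * (Real.pi * (2 * R ^ 2) / (2 * S)))) / (2 * S) ^ 2
      = - (1 / (2 * S)) * (R ^ 2) * (1 / T) := by
    rw [← hk]; field_simp; ring
  rw [e1]
  field_simp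
  push_cast
  ring

/-- The two-mode function
`p(t,x,s) = B₀(t,x) + (e^{A₁₁t} B₁(t,x) + (A₁₀/A₁₁)(e^{A₁₁t} − 1) B₀(t,x)) X₁(s)`,
built from the symmetric/antisymmetric combinations `B₀, B₁` of two drifting heat
kernels centred at `m₁` and `m₂`, solves the integro-differential Kolmogorov forward
equation with two-mode kernel `K(s,ξ) = A₁₀X₁(s) + A₁₁X₁(s)X₁(ξ)`, constant drift `c`
and diffusion `R > 0`, with initial data `g₀(x) + g₁(x)X₁(s)`. -/
theorem explicit_solution_stepwise_gaussian
    (R c m1 m2 A10 A11 : ℝ) (hR : 0 < R) (hA11 : A11 < 0)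
    (X1 : ℝ → ℝ)
    (hX1bdd : ∃ M, ∀ s ∈ Icc (0:ℝ) 1, |X1 s| ≤ M)
    (hX1int : IntervalIntegrable X1 volume 0 1)
    (hX1mean : (∫ s in (0:ℝ)..1, X1 s) = 0)
    (hX1norm : (∫ s in (0:ℝ)..1, (X1 s) ^ 2) = 1)
    (K : ℝ → ℝ → ℝ)
    (hK : ∀ s ξ : ℝ, K s ξ = A10 * X1 s + A11 * X1 s * X1 ξ)
    (B0 B1 : ℝ → ℝ → ℝ)
    (hB0 : ∀ t x : ℝ, B0 t x = (1 / (2 * Real.sqrt (Real.pi * (1 + 2 * R ^ 2 * t))))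
        * (Real.exp (-(x - m1 - c * t) ^ 2 / (1 + 2 * R ^ 2 * t))
          + Real.exp (-(x - m2 - c * t) ^ 2 / (1 + 2 * R ^ 2 * t))))
    (hB1 : ∀ t x : ℝ, B1 t x = (1 / (2 * Real.sqrt (Real.pi * (1 + 2 * R ^ 2 * t))))
        * (Real.exp (-(x - m1 - c * t) ^ 2 / (1 + 2 * R ^ 2 * t))
          - Real.exp (-(x - m2 - c * t) ^ 2 / (1 + 2 * R ^ 2 * t))))
    (p : ℝ → ℝ → ℝ → ℝ)
    (hp : ∀ t x s : ℝ, p t x s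
      = B0 t x + (Real.exp (A11 * t) * B1 t x
          + A10 / A11 * (Real.exp (A11 * t) - 1) * B0 t x) * X1 s)
    (g0 g1 : ℝ → ℝ)
    (hg0 : ∀ x : ℝ, g0 x = (1 / (2 * Real.sqrt Real.pi))
        * (Real.exp (-(x - m1) ^ 2) + Real.exp (-(x - m2) ^ 2)))
    (hg1 : ∀ x : ℝ, g1 x = (1 / (2 * Real.sqrt Real.pi))
        * (Real.exp (-(x - m1) ^ 2) - Real.exp (-(x - m2) ^ 2))) :
    (∀ t ∈ Ioi (0:ℝ), ∀ x : ℝ, ∀ s ∈ Icc (0:ℝ) 1,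
      deriv (fun τ => p τ x s) t
        = (∫ ξ in (0:ℝ)..1, K s ξ * p t x ξ)
          - c * deriv (fun y => p t y s) x
          + R ^ 2 / 2 * deriv (deriv (fun y => p t y s)) x)
    ∧ (∀ x : ℝ, ∀ s ∈ Icc (0:ℝ) 1, p 0 x s = g0 x + g1 x * X1 s) := by
  have e0 : ∀ t x, B0 t x = uK R c m1 t x + uK R c m2 t x := by
    intro t x; rw [hB0]; unfold uK; ring
  have e1 : ∀ t x, B1 t x = uK R c m1 t x - uK R c m2 t x := by
    intro t x; rw [hB1]; unfold uK; ring
  have hA : A11 ≠ 0 := hA11.ne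
  constructor
  · intro t ht x s _
    have ht' : 0 < t := ht
    have hsq : IntervalIntegrable (fun s => X1 s ^ 2) volume 0 1 := by
      by_contra h
      rw [intervalIntegral.integral_undef h] at hX1norm
      norm_num at hX1norm
    have hint : ∀ b a : ℝ, (∫ ξ in (0:ℝ)..1, K s ξ * (b + a * X1 ξ))
        = A10 * X1 s * b + A11 * X1 s * a := by
      intro b a
      have : (fun ξ => K s ξ * (b + a * X1 ξ)) = fun ξ =>
          (A10 * X1 s * b + (A10 * X1 s * a + A11 * X1 s * b) * X1 ξ)
            + (A11 * X1 s * a) * X1 ξ ^ 2 := by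
        funext ξ; rw [hK]; ring
      rw [this, intervalIntegral.integral_add
        (intervalIntegrable_const.add (hX1int.const_mul _)) (hsq.const_mul _),
        intervalIntegral.integral_add intervalIntegrable_const (hX1int.const_mul _),
        intervalIntegral.integral_const_mul, intervalIntegral.integral_const_mul,
        intervalIntegral.integral_const_mul,
        hX1mean, hX1norm]
      simp
    have hI : (∫ ξ in (0:ℝ)..1, K s ξ * p t x ξ) = A10 * X1 s * B0 t x + A11 * X1 s *
        (Real.exp (A11 * t) * B1 t x + A10 / A11 * (Real.exp (A11 * t) - 1) * B0 t x) := by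
      simp only [hp]
      exact hint _ _
    rw [hI]
    have hpe : ∀ τ y, p τ y s = (uK R c m1 τ y + uK R c m2 τ y) +
        (Real.exp (A11 * τ) * (uK R c m1 τ y - uK R c m2 τ y)
          + A10 / A11 * (Real.exp (A11 * τ) - 1) * (uK R c m1 τ y + uK R c m2 τ y)) * X1 s := by
      intro τ y; rw [hp, e0, e1]
    simp only [hpe, e0, e1]
    have hx : ∀ y, HasDerivAt (fun y => (uK R c m1 t y + uK R c m2 t y) +
        (Real.exp (A11 * t) * (uK R c m1 t y - uK R c m2 t y)
          + A10 / A11 * (Real.exp (A11 * t) - 1) * (uK R c m1 t y + uK R c m2 t y)) * X1 s) _ y :=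
      fun y => ((uK_x R c m1 t y).add (uK_x R c m2 t y)).add
        (((((uK_x R c m1 t y).sub (uK_x R c m2 t y)).const_mul (Real.exp (A11 * t))).add
        (((uK_x R c m1 t y).add (uK_x R c m2 t y)).const_mul
          (A10 / A11 * (Real.exp (A11 * t) - 1)))).mul_const (X1 s))
    have hxx := ((uK_xx R c m1 t x).add (uK_xx R c m2 t x)).add
        (((((uK_xx R c m1 t x).sub (uK_xx R c m2 t x)).const_mul (Real.exp (A11 * t))).add
        (((uK_xx R c m1 t x).add (uK_xx R c m2 t x)).const_mul
          (A10 / A11 * (Real.exp (A11 * t) - 1)))).mul_const (X1 s))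
    have hE : HasDerivAt (fun τ : ℝ => Real.exp (A11 * τ)) (Real.exp (A11 * t) * A11) t := by
      simpa using ((hasDerivAt_id t).const_mul A11).exp
    have h1 := uK_t R c m1 t x ht'
    have h2 := uK_t R c m2 t x ht'
    have htt := (h1.add h2).add (((hE.mul (h1.sub h2)).add
      (((hE.sub_const 1).const_mul (A10 / A11)).mul (h1.add h2))).mul_const (X1 s))
    have d1 := htt.deriv
    have d2 := fun y => (hx y).deriv
    have d3 := hxx.deriv
    refine d1.trans ?_
    rw [funext d2]
    refine Eq.trans ?_ (congrArg (fun w => _ + R ^ 2 / 2 * w) d3.symm)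
    simp only [Pi.add_apply, Pi.sub_apply]
    generalize -2 * (x - m1 - c * t) / (1 + 2 * R ^ 2 * t) = a1
    generalize -2 * (x - m2 - c * t) / (1 + 2 * R ^ 2 * t) = a2
    generalize 2 / (1 + 2 * R ^ 2 * t) = a3
    have hq : A10 = A10 / A11 * A11 := by field_simp
    generalize A10 / A11 = q at hq ⊢
    rw [hq]
    ring
  · intro x s _
    rw [hp, hB0, hB1, hg0, hg1]
    simp
end

section
/- Let R > 0, c ∈ ℝ, m₁, m₂ ∈ ℝ, A₁₀ ∈ ℝ, A₁₁ < 0, and let X₁ : [0,1] → ℝ be bounded with ∫₀¹ X₁ ds = 0 and ∫₀¹ X₁² ds = 1. With B₀(t,x) = (2√(π(1+2R²t)))^{−1}(e^{−(x−m₁−ct)²/(1+2R²t)} + e^{−(x−m₂−ct)²/(1+2R²t)}), B₁(t,x) = (2√(π(1+2R²t)))^{−1}(e^{−(x−m₁−ct)²/(1+2R²t)} − e^{−(x−m₂−ct)²/(1+2R²t)}), and p(t,x,s) = B₀(t,x) + (e^{A₁₁ t} B₁(t,x) + (A₁₀/A₁₁)(e^{A₁₁ t} − 1) B₀(t,x))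 X₁(s), one has for all t > 0, x ∈ ℝ, s ∈ [0,1]: |p(t,x,s) − (1 − (A₁₀/A₁₁) X₁(s)) B₀(t,x)| ≤ e^{A₁₁ t} (1 + |A₁₀/A₁₁|) |X₁(s)| (π(1+2R²t))^{−1/2}; in particular, since A₁₁ < 0, sup_{x∈ℝ} |p(t,x,s) − (1 − (A₁₀/A₁₁) X₁(s)) B₀(t,x)| → 0 exponentially fast as t → ∞. -/
open Set MeasureTheory Filter

/-- Long-time asymptotics of the two-mode solution with stepwise Gaussian data:
`|p(t,x,s) − (1 − (A₁₀/A₁₁)X₁(s)) B₀(t,x)| ≤ e^{A₁₁t}(1 + |A₁₀/A₁₁|)|X₁(s)| (π(1+2R²t))^{-1/2}`,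
and in particular, since `A₁₁ < 0`, `sup_x |p(t,x,s) − (1 − (A₁₀/A₁₁)X₁(s)) B₀(t,x)| → 0`
as `t → ∞`. -/
theorem long_time_asymptotics_stepwise_gaussian
    (R c m1 m2 A10 A11 : ℝ) (hR : 0 < R) (hA11 : A11 < 0)
    (X1 : ℝ → ℝ)
    (hX1bdd : ∃ M, ∀ s ∈ Icc (0:ℝ) 1, |X1 s| ≤ M)
    (hX1mean : (∫ s in (0:ℝ)..1, X1 s) = 0)
    (hX1norm : (∫ s in (0:ℝ)..1, (X1 s) ^ 2) = 1)
    (B0 B1 : ℝ → ℝ → ℝ)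
    (hB0 : ∀ t x : ℝ, B0 t x = (1 / (2 * Real.sqrt (Real.pi * (1 + 2 * R ^ 2 * t))))
        * (Real.exp (-(x - m1 - c * t) ^ 2 / (1 + 2 * R ^ 2 * t))
          + Real.exp (-(x - m2 - c * t) ^ 2 / (1 + 2 * R ^ 2 * t))))
    (hB1 : ∀ t x : ℝ, B1 t x = (1 / (2 * Real.sqrt (Real.pi * (1 + 2 * R ^ 2 * t))))
        * (Real.exp (-(x - m1 - c * t) ^ 2 / (1 + 2 * R ^ 2 * t))
          - Real.exp (-(x - m2 - c * t) ^ 2 / (1 + 2 * R ^ 2 * t))))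
    (p : ℝ → ℝ → ℝ → ℝ)
    (hp : ∀ t x s : ℝ, p t x s
      = B0 t x + (Real.exp (A11 * t) * B1 t x
          + A10 / A11 * (Real.exp (A11 * t) - 1) * B0 t x) * X1 s) :
    (∀ t ∈ Ioi (0:ℝ), ∀ x : ℝ, ∀ s ∈ Icc (0:ℝ) 1,
      |p t x s - (1 - A10 / A11 * X1 s) * B0 t x|
        ≤ Real.exp (A11 * t) * (1 + |A10 / A11|) * |X1 s|
            * (1 / Real.sqrt (Real.pi * (1 + 2 * R ^ 2 * t))))
    ∧ (∀ s ∈ Icc (0:ℝ) 1,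
        Tendsto (fun t => ⨆ x : ℝ, |p t x s - (1 - A10 / A11 * X1 s) * B0 t x|)
          atTop (nhds 0)) := by
  have key : ∀ t ∈ Ioi (0:ℝ), ∀ x : ℝ, ∀ s ∈ Icc (0:ℝ) 1,
      |p t x s - (1 - A10 / A11 * X1 s) * B0 t x|
        ≤ Real.exp (A11 * t) * (1 + |A10 / A11|) * |X1 s|
            * (1 / Real.sqrt (Real.pi * (1 + 2 * R ^ 2 * t))) := by
    intro t ht x s _
    have ht' : 0 < t := ht
    have hD : 0 < 1 + 2 * R ^ 2 * t := by positivity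
    have hS : 0 < Real.sqrt (Real.pi * (1 + 2 * R ^ 2 * t)) :=
      Real.sqrt_pos.mpr (mul_pos Real.pi_pos hD)
    have hexp : ∀ y : ℝ, Real.exp (-y ^ 2 / (1 + 2 * R ^ 2 * t)) ≤ 1 := by
      intro y
      rw [Real.exp_le_one_iff]
      exact div_nonpos_of_nonpos_of_nonneg (by nlinarith [sq_nonneg y]) hD.le
    have h1 := hexp (x - m1 - c * t)
    have h2 := hexp (x - m2 - c * t)
    have h1p := Real.exp_pos (-(x - m1 - c * t) ^ 2 / (1 + 2 * R ^ 2 * t))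
    have h2p := Real.exp_pos (-(x - m2 - c * t) ^ 2 / (1 + 2 * R ^ 2 * t))
    have hb : ∀ u : ℝ, |u| ≤ 2 →
        |1 / (2 * Real.sqrt (Real.pi * (1 + 2 * R ^ 2 * t))) * u|
          ≤ 1 / Real.sqrt (Real.pi * (1 + 2 * R ^ 2 * t)) := by
      intro u hu
      have hq : 0 < 1 / (2 * Real.sqrt (Real.pi * (1 + 2 * R ^ 2 * t))) := by positivity
      rw [abs_mul, abs_of_pos hq]
      calc _ ≤ 1 / (2 * Real.sqrt (Real.pi * (1 + 2 * R ^ 2 * t))) * 2 :=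
            mul_le_mul_of_nonneg_left hu hq.le
        _ = _ := by field_simp
    have b0 : |B0 t x| ≤ 1 / Real.sqrt (Real.pi * (1 + 2 * R ^ 2 * t)) := by
      rw [hB0]
      exact hb _ (abs_le.mpr ⟨by linarith, by linarith⟩)
    have b1 : |B1 t x| ≤ 1 / Real.sqrt (Real.pi * (1 + 2 * R ^ 2 * t)) := by
      rw [hB1]
      exact hb _ (abs_le.mpr ⟨by linarith, by linarith⟩)
    have e : p t x s - (1 - A10 / A11 * X1 s) * B0 t x
        = Real.exp (A11 * t) * X1 s * (B1 t x + A10 / A11 * B0 t x) := by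
      rw [hp]; ring
    rw [e, abs_mul, abs_mul, abs_of_pos (Real.exp_pos _)]
    have h3 : |B1 t x + A10 / A11 * B0 t x|
        ≤ (1 + |A10 / A11|) * (1 / Real.sqrt (Real.pi * (1 + 2 * R ^ 2 * t))) := by
      have := abs_add_le (B1 t x) (A10 / A11 * B0 t x)
      rw [abs_mul] at this
      have := mul_le_mul_of_nonneg_left b0 (abs_nonneg (A10 / A11))
      linarith
    calc _ ≤ Real.exp (A11 * t) * |X1 s| *
          ((1 + |A10 / A11|) * (1 / Real.sqrt (Real.pi * (1 + 2 * R ^ 2 * t)))) :=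
          mul_le_mul_of_nonneg_left h3 (by positivity)
      _ = _ := by ring
  refine ⟨key, fun s hs => ?_⟩
  have hlim : Tendsto (fun t : ℝ => Real.exp (A11 * t) * ((1 + |A10 / A11|) * |X1 s|))
      atTop (nhds 0) := by
    have h := (Real.tendsto_exp_atBot.comp
      (tendsto_id.const_mul_atTop_of_neg hA11)).mul_const ((1 + |A10 / A11|) * |X1 s|)
    rw [zero_mul] at h
    exact h
  refine tendsto_of_tendsto_of_tendsto_of_le_of_le' tendsto_const_nhds hlim
    (Eventually.of_forall fun t => Real.iSup_nonneg fun x => abs_nonneg _) ?_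
  filter_upwards [eventually_gt_atTop (0:ℝ)] with t ht
  refine ciSup_le fun x => (key t ht x s hs).trans ?_
  have hS : 1 ≤ Real.sqrt (Real.pi * (1 + 2 * R ^ 2 * t)) := by
    rw [Real.one_le_sqrt]
    have : 0 ≤ 2 * R ^ 2 * t := by positivity
    nlinarith [Real.pi_gt_three]
  have h1 : 1 / Real.sqrt (Real.pi * (1 + 2 * R ^ 2 * t)) ≤ 1 :=
    (div_le_one (by linarith)).mpr hS
  calc _ ≤ Real.exp (A11 * t) * (1 + |A10 / A11|) * |X1 s| * 1 :=
        mul_le_mul_of_nonneg_left h1 (by positivity)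
    _ = _ := by ring
end

section
/- Let R > 0, b < 0, c ∈ ℝ, m₁, m₂ ∈ ℝ, A₁₀ ∈ ℝ, A₁₁ < 0, and let X₁ : [0,1] → ℝ be bounded and integrable with ∫₀¹ X₁(s) ds = 0 and ∫₀¹ X₁(s)² ds = 1. Define K(s,ξ) = A₁₀ X₁(s) + A₁₁ X₁(s) X₁(ξ) and, for t > 0, the Ornstein–Uhlenbeck kernels G_m(t,x) = (−π(R²/b)(1 − e^{2bt}))^{−1/2} exp(−(x − m e^{bt} + (c/b)(1 − e^{bt}))² / (−(R²/b)(1 − e^{2bt}))) for m ∈ {m₁, m₂}, and set B₀ = (G_{m₁} + G_{m₂})/2, B₁ = (G_{m₁} − G_{m₂})/2, p(t,x,s) = B₀(t,x) + (e^{A₁₁ t} B₁(t,x) + (A₁₀/A₁₁)(e^{A₁₁ t} − 1) B₀(t,x)) X₁(s). Then p satisfies ∂_t p(t,x,s) = ∫₀¹ K(s,ξ) p(t,x,ξ) dξ − ∂_x((bx + c) p(t,x,s)) + (R²/2) ∂²_x p(t,x,s) for all t > 0, x ∈ ℝ, s ∈ [0,1]. -/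
open Set MeasureTheory

lemma ou_kernel (R b c m : ℝ) (hR : 0 < R) (hb : b < 0) (G : ℝ → ℝ → ℝ)
    (hG : ∀ t ∈ Ioi (0:ℝ), ∀ x : ℝ, G t x
      = (1 / Real.sqrt (-(Real.pi * (R ^ 2 / b) * (1 - Real.exp (2 * b * t)))))
        * Real.exp (-(x - m * Real.exp (b * t) + c / b * (1 - Real.exp (b * t))) ^ 2
            / (-(R ^ 2 / b) * (1 - Real.exp (2 * b * t))))) (t : ℝ) (ht : 0 < t) :
    ∃ Gx Gxx : ℝ → ℝ, (∀ y, HasDerivAt (fun y => G t y) (Gx y) y) ∧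
      (∀ y, HasDerivAt Gx (Gxx y) y) ∧
      ∀ x, HasDerivAt (fun τ => G τ x)
        (-(b * G t x + (b * x + c) * Gx x) + R ^ 2 / 2 * Gxx x) t := by
  obtain ⟨D, hD⟩ : ∃ D : ℝ → ℝ, D = fun τ => -(R ^ 2 / b) * (1 - Real.exp (2 * b * τ)) := ⟨_, rfl⟩
  obtain ⟨μ, hμ⟩ : ∃ μ : ℝ → ℝ, μ = fun τ => m * Real.exp (b * τ) - c / b * (1 - Real.exp (b * τ)) :=
    ⟨_, rfl⟩
  have hb0 : b ≠ 0 := hb.ne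
  have hpi := Real.pi_pos
  have hG' : ∀ τ ∈ Ioi (0:ℝ), ∀ x : ℝ, G τ x
      = (Real.sqrt (Real.pi * D τ))⁻¹ * Real.exp (-((x - μ τ) ^ 2 / D τ)) := by
    intro τ hτ x
    rw [hG τ hτ x, hD, hμ, one_div]
    simp only
    congr 1
    · congr 2; ring
    · congr 1; rw [neg_div]; congr 3; ring
  have hDpos : 0 < D t := by
    rw [hD]
    have h1 : Real.exp (2 * b * t) < 1 := by
      rw [Real.exp_lt_one_iff]; nlinarith
    have h2 : 0 < -(R ^ 2 / b) := by
      rw [← div_neg]; exact div_pos (by positivity) (by linarith)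
    exact mul_pos h2 (by linarith)
  have hDd : HasDerivAt D (2 * b * D t + 2 * R ^ 2) t := by
    have h0 : HasDerivAt (fun τ : ℝ => 2 * b * τ) (2 * b) t := by
      simpa using (hasDerivAt_id t).const_mul (2 * b)
    have h := ((h0.exp).const_sub 1).const_mul (-(R ^ 2 / b))
    rw [hD]
    refine h.congr_deriv ?_
    field_simp
    ring
  have hμd : HasDerivAt μ (b * μ t + c) t := by
    have h0 : HasDerivAt (fun τ : ℝ => b * τ) b t := by
      simpa using (hasDerivAt_id t).const_mul b
    have h := ((h0.exp).const_mul m).sub (((h0.exp).const_sub 1).const_mul (c / b))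
    rw [hμ]
    refine h.congr_deriv ?_
    field_simp
    ring
  clear hD hμ hG
  have hD0 := hDpos.ne'
  have hGx : ∀ y, HasDerivAt (fun y => G t y) (-(2 * (y - μ t) / D t) * G t y) y := by
    intro y
    have h := ((((hasDerivAt_id y).sub_const (μ t)).pow 2).div_const (D t)).neg.exp.const_mul
      (Real.sqrt (Real.pi * D t))⁻¹
    have e : (fun y => G t y) = fun y => (Real.sqrt (Real.pi * D t))⁻¹ * Real.exp (-((y - μ t) ^ 2 / D t)) :=
      funext fun y => hG' t ht y
    rw [e, hG' t ht y]
    refine h.congr_deriv ?_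
    simp
    ring
  refine ⟨fun y => -(2 * (y - μ t) / D t) * G t y,
    fun y => -(2 / D t) * G t y + -(2 * (y - μ t) / D t) * (-(2 * (y - μ t) / D t) * G t y),
    hGx, ?_, ?_⟩
  · intro y
    have h1 : HasDerivAt (fun y => -(2 * (y - μ t) / D t)) (-(2 / D t)) y := by
      refine ((((hasDerivAt_id y).sub_const (μ t)).const_mul 2).div_const (D t)).neg.congr_deriv ?_
      simp
    exact h1.mul (hGx y)
  · intro x
    have hpd : Real.pi * D t ≠ 0 := by positivity
    have hs : Real.sqrt (Real.pi * D t) ≠ 0 := by positivity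
    have hsq : Real.sqrt (Real.pi * D t) ^ 2 = Real.pi * D t := Real.sq_sqrt (by positivity)
    have h1 := ((hDd.const_mul Real.pi).sqrt hpd).inv hs
    have h2 := ((((hμd.const_sub x).pow 2).div hDd hD0).neg).exp
    have h := h1.mul h2
    have e : (fun τ => G τ x) =ᶠ[nhds t]
        fun τ => (Real.sqrt (Real.pi * D τ))⁻¹ * Real.exp (-((x - μ τ) ^ 2 / D τ)) := by
      filter_upwards [Ioi_mem_nhds ht] with τ hτ using hG' τ hτ x
    refine HasDerivAt.congr_of_eventuallyEq ?_ e
    refine h.congr_deriv ?_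
    simp only [hG' t ht x]
    simp only [Pi.div_apply, Pi.pow_apply, Pi.neg_apply, Pi.inv_apply]
    rw [hsq]
    generalize Real.exp _ = E
    generalize Real.sqrt (Real.pi * D t) = S at *
    field_simp
    ring

/-- The two-mode function built from the Ornstein–Uhlenbeck fundamental kernels
`G_m` centred at `m₁` and `m₂`,
`p(t,x,s) = B₀(t,x) + (e^{A₁₁t} B₁(t,x) + (A₁₀/A₁₁)(e^{A₁₁t} − 1) B₀(t,x)) X₁(s)`
with `B₀ = (G_{m₁} + G_{m₂})/2`, `B₁ = (G_{m₁} − G_{m₂})/2`, solves the generalized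
Ornstein–Uhlenbeck regime-switching Kolmogorov forward equation with two-mode kernel
`K(s,ξ) = A₁₀X₁(s) + A₁₁X₁(s)X₁(ξ)` for all `t > 0`. -/
theorem explicit_ou_solution_stepwise_dirac
    (R b c m1 m2 A10 A11 : ℝ) (hR : 0 < R) (hb : b < 0) (hA11 : A11 < 0)
    (X1 : ℝ → ℝ)
    (hX1bdd : ∃ M, ∀ s ∈ Icc (0:ℝ) 1, |X1 s| ≤ M)
    (hX1int : IntervalIntegrable X1 volume 0 1)
    (hX1mean : (∫ s in (0:ℝ)..1, X1 s) = 0)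
    (hX1norm : (∫ s in (0:ℝ)..1, (X1 s) ^ 2) = 1)
    (K : ℝ → ℝ → ℝ)
    (hK : ∀ s ξ : ℝ, K s ξ = A10 * X1 s + A11 * X1 s * X1 ξ)
    (G : ℝ → ℝ → ℝ → ℝ)
    (hG : ∀ m : ℝ, ∀ t ∈ Ioi (0:ℝ), ∀ x : ℝ, G m t x
      = (1 / Real.sqrt (-(Real.pi * (R ^ 2 / b) * (1 - Real.exp (2 * b * t)))))
        * Real.exp (-(x - m * Real.exp (b * t) + c / b * (1 - Real.exp (b * t))) ^ 2
            / (-(R ^ 2 / b) * (1 - Real.exp (2 * b * t)))))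
    (B0 B1 : ℝ → ℝ → ℝ)
    (hB0 : ∀ t x : ℝ, B0 t x = (G m1 t x + G m2 t x) / 2)
    (hB1 : ∀ t x : ℝ, B1 t x = (G m1 t x - G m2 t x) / 2)
    (p : ℝ → ℝ → ℝ → ℝ)
    (hp : ∀ t x s : ℝ, p t x s
      = B0 t x + (Real.exp (A11 * t) * B1 t x
          + A10 / A11 * (Real.exp (A11 * t) - 1) * B0 t x) * X1 s) :
    ∀ t ∈ Ioi (0:ℝ), ∀ x : ℝ, ∀ s ∈ Icc (0:ℝ) 1,
      deriv (fun τ => p τ x s) t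
        = (∫ ξ in (0:ℝ)..1, K s ξ * p t x ξ)
          - deriv (fun y => (b * y + c) * p t y s) x
          + R ^ 2 / 2 * deriv (deriv (fun y => p t y s)) x := by
  intro t ht x s hs
  have ht' : 0 < t := ht
  have hA0 : A11 ≠ 0 := hA11.ne
  obtain ⟨U, UU, hU, hUU, hUt⟩ := ou_kernel R b c m1 hR hb (G m1) (hG m1) t ht'
  obtain ⟨V, VV, hV, hVV, hVt⟩ := ou_kernel R b c m2 hR hb (G m2) (hG m2) t ht'
  -- the integral term
  have hsqint : IntervalIntegrable (fun ξ => X1 ξ ^ 2) volume 0 1 := by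
    by_contra hcon
    rw [intervalIntegral.integral_undef hcon] at hX1norm
    exact zero_ne_one hX1norm
  have hI : ∀ P Q : ℝ, (∫ ξ in (0:ℝ)..1, K s ξ * (P + Q * X1 ξ))
      = A10 * X1 s * P + A11 * X1 s * Q := by
    intro P Q
    have e : (fun ξ => K s ξ * (P + Q * X1 ξ)) = fun ξ =>
        (A10 * X1 s * P + (A10 * X1 s * Q + A11 * X1 s * P) * X1 ξ)
          + (A11 * X1 s * Q) * X1 ξ ^ 2 := by
      funext ξ; rw [hK]; ring
    rw [e, intervalIntegral.integral_add
        ((intervalIntegrable_const).add (hX1int.const_mul _)) (hsqint.const_mul _),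
      intervalIntegral.integral_add intervalIntegrable_const (hX1int.const_mul _),
      intervalIntegral.integral_const, intervalIntegral.integral_const_mul,
      intervalIntegral.integral_const_mul, hX1mean, hX1norm]
    simp
  have hpI : (∫ ξ in (0:ℝ)..1, K s ξ * p t x ξ) = A10 * X1 s * B0 t x + A11 * X1 s *
      (Real.exp (A11 * t) * B1 t x + A10 / A11 * (Real.exp (A11 * t) - 1) * B0 t x) := by
    simp only [hp]
    exact hI _ _
  obtain ⟨f, hf⟩ : ∃ f : ℝ → ℝ, f = fun τ => (1 + A10 / A11 * (Real.exp (A11 * τ) - 1) * X1 s) / 2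
    := ⟨_, rfl⟩
  obtain ⟨g, hg⟩ : ∃ g : ℝ → ℝ, g = fun τ => Real.exp (A11 * τ) * X1 s / 2 := ⟨_, rfl⟩
  have hE : HasDerivAt (fun τ : ℝ => Real.exp (A11 * τ)) (Real.exp (A11 * t) * A11) t := by
    have h0 : HasDerivAt (fun τ : ℝ => A11 * τ) A11 t := by
      simpa using (hasDerivAt_id t).const_mul A11
    exact h0.exp
  have hfd : HasDerivAt f (A10 * Real.exp (A11 * t) * X1 s / 2) t := by
    rw [hf]
    refine (((((hE.sub_const 1).const_mul (A10 / A11)).mul_const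
      (X1 s)).const_add 1).div_const 2).congr_deriv ?_
    field_simp
  have hgd : HasDerivAt g (A11 * Real.exp (A11 * t) * X1 s / 2) t := by
    rw [hg]
    refine ((hE.mul_const (X1 s)).div_const 2).congr_deriv ?_
    ring
  have hpe : ∀ τ y, p τ y s = (f τ + g τ) * G m1 τ y + (f τ - g τ) * G m2 τ y := by
    intro τ y
    rw [hp, hB0, hB1, hf, hg]; ring
  have hT := ((hfd.add hgd).mul (hUt x)).add ((hfd.sub hgd).mul (hVt x))
  have hX : ∀ y, HasDerivAt (fun y => p t y s) ((f t + g t) * U y + (f t - g t) * V y) y := by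
    intro y
    simp only [hpe]
    exact ((hU y).const_mul _).add ((hV y).const_mul _)
  have hXX := ((hUU x).const_mul (f t + g t)).add ((hVV x).const_mul (f t - g t))
  have d1 := (hT.congr_of_eventuallyEq
    (f₁ := fun τ => p τ x s) (Filter.Eventually.of_forall fun τ => hpe τ x)).deriv
  have d2 : deriv (fun y => p t y s) = fun y => (f t + g t) * U y + (f t - g t) * V y :=
    funext fun y => (hX y).deriv
  have d3 : deriv (deriv (fun y => p t y s)) x
      = (f t + g t) * UU x + (f t - g t) * VV x := by
    rw [d2]; exact hXX.deriv
  have hL : HasDerivAt (fun y : ℝ => b * y + c) b x := by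
    simpa using ((hasDerivAt_id x).const_mul b).add_const c
  have d4 : deriv (fun y => (b * y + c) * p t y s) x
      = b * p t x s + (b * x + c) * ((f t + g t) * U x + (f t - g t) * V x) :=
    (hL.mul (hX x)).deriv
  rw [d1, d3, d4, hpI, hpe, hB0, hB1]
  simp only [Pi.add_apply, Pi.sub_apply]
  field_simp
  ring
end
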